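/- Distributionally robust safe sample screening (DRSsS) for the weighted L1-loss L2-regularized SVM: let X̌ ∈ ℝ^{n×d}, λ > 0, and let W be a set of nonnegative weight vectors in ℝ^n. For each w ∈ W let β*(w) be the minimizer of P_w(β) = Σᵢ wᵢ max(0, 1 − X̌_{i:}β) + (λ/2)‖β‖₂². Fix i ∈ [n], a reference point β̃ ∈ ℝ^d, and α̃ ∈ [0,1]^n, and suppose R ∈ ℝ satisfies √((2/λ)(P_w(β̃) − D_w(α̃))) ≤ R for every w ∈ W. If X̌_{i:}β̃ − ‖X̌_{i:}‖₂ · R > 1, then X̌_{i:}β*(w) > 1 for every w ∈ W. -/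

import Mathlib

/-- Primal objective of the weighted L1-loss L2-regularized SVM. -/
noncomputable def svmPrimal {n d : ℕ} (X : Matrix (Fin n) (Fin d) ℝ) (w : Fin n → ℝ)
    (lam : ℝ) (β : Fin d → ℝ) : ℝ :=
  ∑ i, w i * max 0 (1 - ∑ j, X i j * β j) + (lam / 2) * ∑ j, (β j) ^ 2

/-- Dual objective of the weighted L1-loss L2-regularized SVM on the box `[0,1]^n`. -/
noncomputable def svmDual {n d : ℕ} (X : Matrix (Fin n) (Fin d) ℝ) (w : Fin n → ℝ)
    (lam : ℝ) (α : Fin n → ℝ) : ℝ :=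
  ∑ i, w i * α i - (1 / (2 * lam)) * ∑ j, (∑ i, w i * α i * X i j) ^ 2

/-- Weak duality. -/
theorem svmDual_le_svmPrimal {n d : ℕ} (X : Matrix (Fin n) (Fin d) ℝ) {w : Fin n → ℝ}
    (hw : ∀ i, 0 ≤ w i) {lam : ℝ} (hlam : 0 < lam) {α : Fin n → ℝ}
    (hα : ∀ i, 0 ≤ α i ∧ α i ≤ 1) (β : Fin d → ℝ) :
    svmDual X w lam α ≤ svmPrimal X w lam β := by
  unfold svmDual svmPrimal
  have hinge : ∑ i, w i * (α i * (1 - ∑ j, X i j * β j))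
      ≤ ∑ i, w i * max 0 (1 - ∑ j, X i j * β j) := by
    refine Finset.sum_le_sum fun i _ => mul_le_mul_of_nonneg_left ?_ (hw i)
    calc α i * (1 - ∑ j, X i j * β j) ≤ α i * max 0 (1 - ∑ j, X i j * β j) :=
          mul_le_mul_of_nonneg_left (le_max_right _ _) (hα i).1
      _ ≤ 1 * max 0 (1 - ∑ j, X i j * β j) :=
          mul_le_mul_of_nonneg_right (hα i).2 (le_max_left _ _)
      _ = _ := one_mul _
  have linear : ∑ i, w i * (α i * (1 - ∑ j, X i j * β j))
      = ∑ i, w i * α i - ∑ j, (∑ i, w i * α i * X i j) * β j := by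
    simp_rw [Finset.sum_mul]
    rw [Finset.sum_comm, ← Finset.sum_sub_distrib]
    refine Finset.sum_congr rfl fun i _ => ?_
    simp_rw [mul_assoc, ← Finset.mul_sum]
    ring
  have young : ∑ j, (∑ i, w i * α i * X i j) * β j
      ≤ (1 / (2 * lam)) * ∑ j, (∑ i, w i * α i * X i j) ^ 2 + (lam / 2) * ∑ j, β j ^ 2 := by
    rw [Finset.mul_sum, Finset.mul_sum, ← Finset.sum_add_distrib]
    refine Finset.sum_le_sum fun j _ => ?_
    generalize ∑ i, w i * α i * X i j = v
    have square : 1 / (2 * lam) * v ^ 2 + lam / 2 * β j ^ 2 - v * β j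
        = 1 / (2 * lam) * (v - lam * β j) ^ 2 := by
      field_simp
      ring
    have : 0 ≤ 1 / (2 * lam) * (v - lam * β j) ^ 2 := by positivity
    linarith
  linarith

/-- The primal objective is `lam`-strongly convex. -/
theorem svmPrimal_segment_le {n d : ℕ} (X : Matrix (Fin n) (Fin d) ℝ) {w : Fin n → ℝ}
    (hw : ∀ i, 0 ≤ w i) (lam : ℝ) (β γ : Fin d → ℝ) {t : ℝ} (ht₀ : 0 ≤ t) (ht₁ : t ≤ 1) :
    svmPrimal X w lam (fun j => (1 - t) * β j + t * γ j)
      ≤ (1 - t) * svmPrimal X w lam β + t * svmPrimal X w lam γ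
        - lam / 2 * (t * (1 - t)) * ∑ j, (γ j - β j) ^ 2 := by
  unfold svmPrimal
  have hinge : ∑ i, w i * max 0 (1 - ∑ j, X i j * ((1 - t) * β j + t * γ j))
      ≤ (1 - t) * ∑ i, w i * max 0 (1 - ∑ j, X i j * β j)
        + t * ∑ i, w i * max 0 (1 - ∑ j, X i j * γ j) := by
    rw [Finset.mul_sum, Finset.mul_sum, ← Finset.sum_add_distrib]
    refine Finset.sum_le_sum fun i _ => ?_
    have linear : ∑ j, X i j * ((1 - t) * β j + t * γ j)
        = (1 - t) * ∑ j, X i j * β j + t * ∑ j, X i j * γ j := by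
      rw [Finset.mul_sum, Finset.mul_sum, ← Finset.sum_add_distrib]
      exact Finset.sum_congr rfl fun j _ => by ring
    rw [linear]
    generalize ∑ j, X i j * β j = a
    generalize ∑ j, X i j * γ j = b
    have convex : max 0 (1 - ((1 - t) * a + t * b))
        ≤ (1 - t) * max 0 (1 - a) + t * max 0 (1 - b) := by
      have ht : 0 ≤ 1 - t := by linarith
      refine max_le (by positivity) ?_
      have ha := mul_le_mul_of_nonneg_left (le_max_right 0 (1 - a)) ht
      have hb := mul_le_mul_of_nonneg_left (le_max_right 0 (1 - b)) ht₀
      linarith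
    have := mul_le_mul_of_nonneg_left convex (hw i)
    linarith
  have quadratic : ∑ j, ((1 - t) * β j + t * γ j) ^ 2
      = (1 - t) * ∑ j, β j ^ 2 + t * ∑ j, γ j ^ 2
        - t * (1 - t) * ∑ j, (γ j - β j) ^ 2 := by
    simp_rw [Finset.mul_sum]
    rw [← Finset.sum_add_distrib, ← Finset.sum_sub_distrib]
    exact Finset.sum_congr rfl fun j _ => by ring
  rw [quadratic]
  linarith

/-- Quadratic growth of the primal objective around its minimizer. -/
theorem svmPrimal_quadratic_growth {n d : ℕ} (X : Matrix (Fin n) (Fin d) ℝ) {w : Fin n → ℝ}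
    (hw : ∀ i, 0 ≤ w i) (lam : ℝ) {β : Fin d → ℝ}
    (hmin : ∀ γ, svmPrimal X w lam β ≤ svmPrimal X w lam γ) (γ : Fin d → ℝ) :
    lam / 2 * ∑ j, (γ j - β j) ^ 2 ≤ svmPrimal X w lam γ - svmPrimal X w lam β := by
  set q := lam / 2 * ∑ j, (γ j - β j) ^ 2 with hq
  have step : ∀ t ∈ Set.Ioo (0 : ℝ) 1,
      (1 - t) * q ≤ svmPrimal X w lam γ - svmPrimal X w lam β := by
    rintro t ⟨ht₀, ht₁⟩
    have h := (hmin _).trans (svmPrimal_segment_le X hw lam β γ ht₀.le ht₁.le)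
    refine le_of_mul_le_mul_left ?_ ht₀
    rw [hq]
    linarith
  have lim : Filter.Tendsto (fun t : ℝ => (1 - t) * q) (nhdsWithin 0 (Set.Ioi 0)) (nhds q) := by
    have : Continuous fun t : ℝ => (1 - t) * q := by fun_prop
    simpa using (this.tendsto 0).mono_left nhdsWithin_le_nhds
  exact le_of_tendsto lim
    (Filter.mem_of_superset (Ioo_mem_nhdsGT one_pos) step)

/-- Distributionally robust safe sample screening (DRSsS) for the
weighted L1-loss L2-regularized SVM: if `R` upper-bounds the gap radius
`√((2/λ)(P_w(β̃) − D_w(α̃)))` for every `w ∈ W`, and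
`X̌_{i:}β̃ − ‖X̌_{i:}‖₂ · R > 1`, then `X̌_{i:}β*(w) > 1` for every `w ∈ W`. -/
theorem stmt7 {n d : ℕ} (X : Matrix (Fin n) (Fin d) ℝ) (lam : ℝ) (hlam : 0 < lam)
    (W : Set (Fin n → ℝ)) (hW : ∀ w ∈ W, ∀ i, 0 ≤ w i)
    (βs : (Fin n → ℝ) → (Fin d → ℝ))
    (hmin : ∀ w ∈ W, ∀ β : Fin d → ℝ, svmPrimal X w lam (βs w) ≤ svmPrimal X w lam β)
    (i : Fin n) (βt : Fin d → ℝ) (αt : Fin n → ℝ)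
    (hαt : ∀ k, 0 ≤ αt k ∧ αt k ≤ 1)
    (R : ℝ)
    (hR : ∀ w ∈ W, Real.sqrt ((2 / lam) * (svmPrimal X w lam βt - svmDual X w lam αt)) ≤ R)
    (hrule : 1 < (∑ j, X i j * βt j) - Real.sqrt (∑ j, (X i j) ^ 2) * R) :
    ∀ w ∈ W, 1 < ∑ j, X i j * βs w j := by
  intro w hw
  have growth := svmPrimal_quadratic_growth X (hW w hw) lam (hmin w hw) βt
  have weak := svmDual_le_svmPrimal X (hW w hw) hlam hαt (βs w)
  have ball : √(∑ j, (βt j - βs w j) ^ 2) ≤ R := by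
    refine (Real.sqrt_le_sqrt ?_).trans (hR w hw)
    calc ∑ j, (βt j - βs w j) ^ 2 = 2 / lam * (lam / 2 * ∑ j, (βt j - βs w j) ^ 2) := by
          field_simp
      _ ≤ _ := mul_le_mul_of_nonneg_left (by linarith) (by positivity)
  have cauchy := Real.sum_mul_le_sqrt_mul_sqrt Finset.univ (X i) fun j => βt j - βs w j
  have bound := mul_le_mul_of_nonneg_left ball (Real.sqrt_nonneg (∑ j, X i j ^ 2))
  simp only [mul_sub, Finset.sum_sub_distrib] at cauchy
  linarith
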